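/- arXiv:1912.06100 — 13 statements merged into one kernel-verified Lean document; each statement's English description precedes it below -/
import Mathlib

section
/- ((K,q) filament ring.) Let K ≥ 2 and q be integers, let D > 0, P > 0 and Ω be real numbers, set ω = (2π/P)·(q/K), assume D·ω² + Ω > 0, and set r = √((K−1)/(2(D·ω² + Ω))). Define ξ_k(z) = r·e^{iωz}·e^{2πik/K} for k ∈ {0, …, K−1} and z ∈ ℝ. Then: (i) for every k and every z ∈ ℝ, 0 = D·ξ_k''(z) − Ω·ξ_k(z) + ∑_{j≠k} (ξ_k(z) − ξ_j(z))/|ξ_k(z) − ξ_j(z)|² (here ξ_k'' denotes the second derivative in z); and (ii) for every k, ξ_k(P) = ξ_{k'}(0), where k' is the residue of k + q modulo K. -/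
open Finset Complex Real

/-- A primitive root to the power of a difference taken in `Fin K`. -/
lemma IsPrimitiveRoot.pow_fin_sub_mul {K : ℕ} [NeZero K] {ζ : ℂ} (hζ : IsPrimitiveRoot ζ K)
    (a b : Fin K) : ζ ^ ((a - b : Fin K) : ℕ) * ζ ^ (b : ℕ) = ζ ^ (a : ℕ) := by
  have h : ((a - b + b : Fin K) : ℕ) = (a : ℕ) := by rw [sub_add_cancel]
  rw [← h, Fin.val_add, ← pow_add, ← pow_eq_pow_mod _ hζ.pow_eq_one]

/-- The sum of `1 / (1 - η)` over the nontrivial `K`-th roots of unity `η = ζ ^ k / ζ ^ j`. -/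
lemma IsPrimitiveRoot.sum_inv_one_sub_div {K : ℕ} {ζ : ℂ} (hζ : IsPrimitiveRoot ζ K)
    (k : Fin K) :
    ∑ j ∈ Finset.univ.erase k, (1 - ζ ^ (k : ℕ) / ζ ^ (j : ℕ))⁻¹ = ((K : ℂ) - 1) / 2 := by
  have : NeZero K := ⟨by have := k.2; omega⟩
  have h0 : ∀ n : ℕ, ζ ^ n ≠ 0 := fun n => pow_ne_zero _ (hζ.ne_zero (NeZero.ne K))
  have hne : ∀ j ∈ Finset.univ.erase k, ζ ^ (j : ℕ) ≠ ζ ^ (k : ℕ) := fun j hj h =>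
    Finset.ne_of_mem_erase hj (Fin.ext (hζ.pow_inj j.2 k.2 h))
  have hrefl : ∑ j ∈ Finset.univ.erase k, (1 - ζ ^ (k : ℕ) / ζ ^ (j : ℕ))⁻¹ =
      ∑ j ∈ Finset.univ.erase k, (1 - ζ ^ (j : ℕ) / ζ ^ (k : ℕ))⁻¹ := by
    refine Finset.sum_equiv (Equiv.subLeft (k + k)) (fun j => ?_) (fun j _ => ?_)
    · simp only [Finset.mem_erase, Finset.mem_univ, and_true, Equiv.subLeft_apply, ne_eq,
        sub_eq_iff_eq_add, add_right_inj]
      exact not_congr eq_comm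
    · have h1 := hζ.pow_fin_sub_mul (k + k) j
      have h2 := hζ.pow_fin_sub_mul (k + k) k
      rw [add_sub_cancel_right] at h2
      rw [← h2] at h1
      rw [Equiv.subLeft_apply]
      congr 2
      rw [div_eq_div_iff (h0 _) (h0 _), h1]
  have hsum : ∑ j ∈ Finset.univ.erase k, (1 - ζ ^ (k : ℕ) / ζ ^ (j : ℕ))⁻¹ +
      ∑ j ∈ Finset.univ.erase k, (1 - ζ ^ (j : ℕ) / ζ ^ (k : ℕ))⁻¹ = (K : ℂ) - 1 := by
    rw [← Finset.sum_add_distrib, Finset.sum_congr rfl (g := fun _ => (1 : ℂ))]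
    · rw [Finset.sum_const, Finset.card_erase_of_mem (Finset.mem_univ k), Finset.card_univ,
        Fintype.card_fin, nsmul_eq_mul, mul_one, Nat.cast_pred (NeZero.pos K)]
    · intro j hj
      have hj1 := sub_ne_zero.2 (hne j hj)
      rw [one_sub_div (h0 j), one_sub_div (h0 k), inv_div, inv_div, ← neg_sub (ζ ^ (j : ℕ)),
        div_neg, ← sub_eq_add_neg, ← sub_div, div_self hj1]
  rw [← hrefl] at hsum
  linear_combination hsum / 2

/-- The velocity induced at one vertex by the other vertices of a regular `K`-gon. -/
lemma IsPrimitiveRoot.sum_sub_div_norm_sq {K : ℕ} {ζ : ℂ} (hζ : IsPrimitiveRoot ζ K)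
    (k : Fin K) (a : ℂ) :
    ∑ j ∈ Finset.univ.erase k, (a * ζ ^ (k : ℕ) - a * ζ ^ (j : ℕ)) /
      ((‖a * ζ ^ (k : ℕ) - a * ζ ^ (j : ℕ)‖ : ℂ) ^ 2) =
    a * ζ ^ (k : ℕ) / (‖a‖ : ℂ) ^ 2 * (((K : ℂ) - 1) / 2) := by
  have hK : K ≠ 0 := by have := k.2; omega
  have h0 : ∀ n : ℕ, ζ ^ n ≠ 0 := fun n => pow_ne_zero _ (hζ.ne_zero hK)
  rcases eq_or_ne a 0 with rfl | ha
  · simp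
  have hconj : ∀ n : ℕ, (starRingEnd ℂ) (ζ ^ n) = (ζ ^ n)⁻¹ := fun n =>
    (Complex.inv_eq_conj (by rw [norm_pow, hζ.norm'_eq_one hK, one_pow])).symm
  rw [← hζ.sum_inv_one_sub_div k, Finset.mul_sum]
  refine Finset.sum_congr rfl fun j hj => ?_
  have hne : ζ ^ (k : ℕ) - ζ ^ (j : ℕ) ≠ 0 := sub_ne_zero.2 fun h =>
    Finset.ne_of_mem_erase hj (Fin.ext (hζ.pow_inj k.2 j.2 h)).symm
  have hne' : ζ ^ (j : ℕ) - ζ ^ (k : ℕ) ≠ 0 := by rwa [← neg_sub, neg_ne_zero]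
  have hca : (starRingEnd ℂ) a ≠ 0 := (map_ne_zero _).2 ha
  have hk := h0 k
  have hj := h0 j
  rw [← Complex.mul_conj', ← Complex.mul_conj', map_sub, map_mul, map_mul, hconj, hconj,
    ← mul_sub, ← mul_sub, inv_sub_inv hk hj, one_sub_div hj, inv_div]
  field_simp

/-- The derivative of a complex exponential along the real line. -/
lemma deriv_const_mul_cexp_mul_ofReal (c w : ℂ) :
    deriv (fun z : ℝ => c * Complex.exp (w * z)) = fun z : ℝ => c * w * Complex.exp (w * z) := by
  funext z
  have h := (((hasDerivAt_id (z : ℂ)).const_mul w).cexp.const_mul c).comp_ofReal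
  refine h.deriv.trans ?_
  simp only [id]
  ring

/-- (K,q) filament ring: with `ω = (2π/P)·(q/K)` and
`r = √((K−1)/(2(Dω²+Ω)))`, the helical curves `ξ_k(z) = r·e^{iωz}·e^{2πik/K}`
(i) satisfy the steady filament equations and (ii) satisfy the doubly-periodic
boundary conditions `ξ_k(P) = ξ_{k+q mod K}(0)`. -/
theorem stmt_2 (K : ℕ) (hK : 2 ≤ K) (q : ℤ) (D P Ω : ℝ) (hD : 0 < D) (hP : 0 < P)
    (ω : ℝ) (hω : ω = (2 * π / P) * ((q : ℝ) / K))
    (hpos : 0 < D * ω ^ 2 + Ω)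
    (r : ℝ) (hr : r = Real.sqrt (((K : ℝ) - 1) / (2 * (D * ω ^ 2 + Ω))))
    (ξ : Fin K → ℝ → ℂ)
    (hξ : ∀ k : Fin K, ∀ z : ℝ,
      ξ k z = (r : ℂ) * Complex.exp (Complex.I * ω * z) *
        Complex.exp (2 * π * Complex.I * k / K)) :
    (∀ k : Fin K, ∀ z : ℝ,
      0 = (D : ℂ) * deriv (deriv (ξ k)) z - (Ω : ℂ) * ξ k z +
        ∑ j ∈ Finset.univ.erase k, (ξ k z - ξ j z) / ((‖ξ k z - ξ j z‖ : ℂ) ^ 2)) ∧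
    (∀ k k' : Fin K, ((k' : ℤ) = ((k : ℤ) + q) % (K : ℤ)) → ξ k P = ξ k' 0) := by
  have hK0 : K ≠ 0 := by omega
  have hKC : (K : ℂ) ≠ 0 := Nat.cast_ne_zero.2 hK0
  refine ⟨fun k z => ?_, fun k k' h => ?_⟩
  · have hζ := Complex.isPrimitiveRoot_exp K hK0
    set ζ := Complex.exp (2 * π * Complex.I / K)
    have hξ' : ∀ j : Fin K, ∀ z : ℝ,
        ξ j z = (r : ℂ) * Complex.exp (Complex.I * ω * z) * ζ ^ (j : ℕ) := fun j z => by
      rw [hξ, ← Complex.exp_nat_mul]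
      congr 2
      ring
    have hder : deriv (deriv (ξ k)) z = -(ω : ℂ) ^ 2 * ξ k z := by
      have hfun : ξ k = fun z : ℝ =>
          (r * ζ ^ (k : ℕ)) * Complex.exp (Complex.I * ω * z) := by
        funext z
        rw [hξ']
        ring
      rw [hfun, deriv_const_mul_cexp_mul_ofReal, deriv_const_mul_cexp_mul_ofReal]
      linear_combination (ω : ℂ) ^ 2 * (r * ζ ^ (k : ℕ)) *
        Complex.exp (Complex.I * ω * z) * Complex.I_sq
    have hK1 : (0 : ℝ) < (K : ℝ) - 1 := by
      have : (2 : ℝ) ≤ K := by exact_mod_cast hK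
      linarith
    have hr2 : r ^ 2 = ((K : ℝ) - 1) / (2 * (D * ω ^ 2 + Ω)) := by
      rw [hr, Real.sq_sqrt (by positivity)]
    have hr0 : r ^ 2 ≠ 0 := by rw [hr2]; positivity
    have hbal : (((K : ℝ) - 1) / 2) / r ^ 2 = D * ω ^ 2 + Ω := by
      rw [div_eq_iff hr0, hr2]
      field_simp
    have hbalC : (((K : ℂ) - 1) / 2) / (r : ℂ) ^ 2 = D * ω ^ 2 + Ω := by exact_mod_cast hbal
    have hnorm : (‖(r : ℂ) * Complex.exp (Complex.I * ω * z)‖ : ℂ) ^ 2 = (r : ℂ) ^ 2 := by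
      rw [norm_mul, mul_assoc, mul_comm Complex.I, ← Complex.ofReal_mul,
        Complex.norm_exp_ofReal_mul_I, mul_one, Complex.norm_real]
      exact_mod_cast sq_abs r
    rw [hder]
    simp only [hξ']
    rw [hζ.sum_sub_div_norm_sq, hnorm]
    linear_combination -((r : ℂ) * Complex.exp (Complex.I * ω * z) * ζ ^ (k : ℕ)) * hbalC
  · have hq : (k : ℤ) + q = k' + K * (((k : ℤ) + q) / K) := by
      rw [h, Int.emod_add_mul_ediv]
    generalize ((k : ℤ) + q) / K = m at hq
    have hqC : (k : ℂ) + q = k' + K * m := by exact_mod_cast hq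
    have hPC : (P : ℂ) ≠ 0 := Complex.ofReal_ne_zero.2 hP.ne'
    rw [hξ, hξ, mul_assoc (r : ℂ), mul_assoc (r : ℂ), ← Complex.exp_add, ← Complex.exp_add]
    congr 1
    refine Complex.exp_eq_exp_iff_exists_int.2 ⟨m, ?_⟩
    rw [hω]
    push_cast
    field_simp
    linear_combination (P : ℂ) * hqC
end

section
/- Let K ≥ 2, let D > 0, Ω, ω be real numbers, let η_1, …, η_K ∈ ℂ be pairwise distinct, and set Γ = D·ω² + Ω. Define ξ_k(z) = e^{iωz}·η_k. Then the family (ξ_k) satisfies the steady filament equations 0 = D·ξ_k''(z) − Ω·ξ_k(z) + ∑_{j≠k} (ξ_k(z) − ξ_j(z))/|ξ_k(z) − ξ_j(z)|² for all z ∈ ℝ and all k if and only if (η_k) satisfies the point-vortex relative-equilibrium equations 0 = −Γ·η_k + ∑_{j≠k} (η_k − η_j)/|η_k − η_j|² for all k. -/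
open Finset Complex

/-- The derivative of `z ↦ e^{iωz}·c` along the real line. -/
theorem hasDerivAt_exp_I_mul_mul_const (ω : ℝ) (c : ℂ) (z : ℝ) :
    HasDerivAt (fun z : ℝ => Complex.exp (Complex.I * ω * z) * c)
      (Complex.exp (Complex.I * ω * z) * (Complex.I * ω * c)) z := by
  have h : HasDerivAt (fun z : ℝ => Complex.I * ω * (z : ℂ)) (Complex.I * ω * 1) z :=
    (Complex.ofRealCLM.hasDerivAt (x := z)).const_mul (Complex.I * ω)
  exact (h.cexp.mul_const c).congr_deriv (by ring)

theorem deriv_deriv_exp_I_mul_mul_const (ω : ℝ) (c : ℂ) (z : ℝ) :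
    deriv (deriv fun z : ℝ => Complex.exp (Complex.I * ω * z) * c) z =
      -(ω : ℂ) ^ 2 * (Complex.exp (Complex.I * ω * z) * c) := by
  rw [funext fun z => (hasDerivAt_exp_I_mul_mul_const ω c z).deriv,
    (hasDerivAt_exp_I_mul_mul_const ω (Complex.I * ω * c) z).deriv]
  linear_combination
    (ω : ℂ) ^ 2 * Complex.exp (Complex.I * ω * z) * c * Complex.I_sq

/-- The vortex interaction is equivariant under rotations. -/
theorem mul_sub_mul_div_norm_sq {u : ℂ} (hu : ‖u‖ = 1) (a b : ℂ) :
    (u * a - u * b) / ((‖u * a - u * b‖ : ℂ) ^ 2) =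
      u * ((a - b) / ((‖a - b‖ : ℂ) ^ 2)) := by
  rw [← mul_sub, norm_mul, hu, one_mul, mul_div_assoc]

/-- The helical family `ξ_k(z) = e^{iωz}·η_k` satisfies the steady filament
equations (with rotation `Ω`) if and only if `(η_k)` is a point-vortex relative
equilibrium with rotation rate `Γ = Dω² + Ω`. -/
theorem stmt_3 (K : ℕ) (hK : 2 ≤ K) (D Ω ω : ℝ) (hD : 0 < D)
    (η : Fin K → ℂ) (hdist : ∀ j k : Fin K, j ≠ k → η j ≠ η k)
    (Γ : ℝ) (hΓ : Γ = D * ω ^ 2 + Ω)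
    (ξ : Fin K → ℝ → ℂ)
    (hξ : ∀ k : Fin K, ∀ z : ℝ, ξ k z = Complex.exp (Complex.I * ω * z) * η k) :
    (∀ k : Fin K, ∀ z : ℝ,
      0 = (D : ℂ) * deriv (deriv (ξ k)) z - (Ω : ℂ) * ξ k z +
        ∑ j ∈ Finset.univ.erase k, (ξ k z - ξ j z) / ((‖ξ k z - ξ j z‖ : ℂ) ^ 2)) ↔
    (∀ k : Fin K,
      0 = -(Γ : ℂ) * η k +
        ∑ j ∈ Finset.univ.erase k, (η k - η j) / ((‖η k - η j‖ : ℂ) ^ 2)) := by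
  have key : ∀ (k : Fin K) (z : ℝ),
      (D : ℂ) * deriv (deriv (ξ k)) z - (Ω : ℂ) * ξ k z +
        ∑ j ∈ Finset.univ.erase k, (ξ k z - ξ j z) / ((‖ξ k z - ξ j z‖ : ℂ) ^ 2) =
      Complex.exp (Complex.I * ω * z) * (-(Γ : ℂ) * η k +
        ∑ j ∈ Finset.univ.erase k, (η k - η j) / ((‖η k - η j‖ : ℂ) ^ 2)) := by
    intro k z
    have hu : ‖Complex.exp (Complex.I * ω * z)‖ = 1 := by simp [Complex.norm_exp]
    rw [funext (hξ k), deriv_deriv_exp_I_mul_mul_const]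
    simp only [hξ, mul_sub_mul_div_norm_sq hu]
    rw [← Finset.mul_sum, hΓ]
    push_cast
    ring
  constructor
  · intro h k
    simpa using (h k 0).trans (key k 0)
  · intro h k z
    rw [key, ← h k, mul_zero]
end

section
/- Let K ≥ 2 and m be integers with 0 ≤ m ≤ K−1. Then ∑_{j=1}^{K−1} (e^{2πij/K} − e^{2πijm/K}) / (4·sin²(πj/K)) = (m−1)(K−m−1)/2, and likewise ∑_{j=1}^{K−1} (e^{2πij/K} − e^{−2πijm/K}) / (4·sin²(πj/K)) = (m−1)(K−m−1)/2. In particular both sums are real and equal. -/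
open Finset Complex Real

section PrimitiveRootSums

variable {F : Type*} [Field F] {ζ : F} {K : ℕ}

/-- The sum of `z ^ n / ((1 - z) * (1 - z⁻¹))` over the powers `z = ζ ^ j`, `1 ≤ j ≤ K - 1`. -/
def rootKernelSum (ζ : F) (K : ℕ) (n : ℤ) : F :=
  ∑ j ∈ Icc 1 (K - 1), (ζ ^ j) ^ n / ((1 - ζ ^ j) * (1 - (ζ ^ j)⁻¹))

lemma IsPrimitiveRoot.rootKernelSum_neg (hζ : IsPrimitiveRoot ζ K) (n : ℤ) :
    rootKernelSum ζ K (-n) = rootKernelSum ζ K n := by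
  refine sum_bij' (fun j _ => K - j) (fun j _ => K - j) ?_ ?_ ?_ ?_ ?_
  · intro j hj; simp only [mem_Icc] at hj ⊢; omega
  · intro j hj; simp only [mem_Icc] at hj ⊢; omega
  · intro j hj; simp only [mem_Icc] at hj ⊢; omega
  · intro j hj; simp only [mem_Icc] at hj ⊢; omega
  · intro j hj
    rw [mem_Icc] at hj
    have h : ζ ^ (K - j) = (ζ ^ j)⁻¹ := by
      refine eq_inv_of_mul_eq_one_left ?_
      rw [← pow_add, Nat.sub_add_cancel (by omega), hζ.pow_eq_one]
    rw [h, inv_inv, inv_zpow, zpow_neg, mul_comm (1 - ζ ^ j)]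

lemma IsPrimitiveRoot.rootKernelSum_second_difference (hζ : IsPrimitiveRoot ζ K) (n : ℤ) :
    rootKernelSum ζ K (n + 1) - 2 * rootKernelSum ζ K n + rootKernelSum ζ K (n - 1) =
      -∑ j ∈ Icc 1 (K - 1), (ζ ^ j) ^ n := by
  simp only [rootKernelSum]
  rw [mul_sum, ← sum_sub_distrib, ← sum_add_distrib, ← sum_neg_distrib]
  refine sum_congr rfl fun j hj => ?_
  rw [mem_Icc] at hj
  have h0 : ζ ^ j ≠ 0 := pow_ne_zero _ (hζ.ne_zero (by omega))
  have h1 : ζ ^ j ≠ 1 := hζ.pow_ne_one_of_pos_of_lt (by omega) (by omega)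
  have h2 : 1 - ζ ^ j ≠ 0 := sub_ne_zero.2 h1.symm
  have h3 : 1 - (ζ ^ j)⁻¹ ≠ 0 := sub_ne_zero.2 fun h => h1 (inv_eq_one.1 h.symm)
  rw [zpow_add_one₀ h0, zpow_sub_one₀ h0]
  generalize (ζ ^ j) ^ n = y
  rw [← mul_div_assoc, ← sub_div, ← add_div, div_eq_iff (mul_ne_zero h2 h3)]
  linear_combination y * mul_inv_cancel₀ h0

lemma IsPrimitiveRoot.sum_Icc_pow_pow (hζ : IsPrimitiveRoot ζ K) {n : ℕ} (hn : 0 < n)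
    (hnK : n < K) : ∑ j ∈ Icc 1 (K - 1), (ζ ^ j) ^ n = -1 := by
  have h1 : ζ ^ n ≠ 1 := hζ.pow_ne_one_of_pos_of_lt hn.ne' hnK
  have hs : ∑ j ∈ range K, (ζ ^ n) ^ j = 0 := by
    rw [geom_sum_eq h1, ← pow_mul, mul_comm, pow_mul, hζ.pow_eq_one, one_pow, sub_self, zero_div]
  have hr : range K = insert 0 (Icc 1 (K - 1)) := by
    ext j; simp only [mem_range, mem_insert, mem_Icc]; omega
  rw [hr, sum_insert (by simp), pow_zero] at hs
  simp only [← pow_mul, mul_comm n] at hs ⊢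
  linear_combination hs

lemma IsPrimitiveRoot.rootKernelSum_one_sub [CharZero F] (hζ : IsPrimitiveRoot ζ K) (hK : 0 < K)
    {m : ℕ} (hm : m ≤ K) :
    rootKernelSum ζ K 1 - rootKernelSum ζ K m = ((m : F) - 1) * ((K : F) - m - 1) / 2 := by
  induction m using Nat.twoStepInduction with
  | zero =>
    have h := hζ.rootKernelSum_second_difference 0
    simp only [zero_add, zero_sub, hζ.rootKernelSum_neg, zpow_zero, sum_const, Nat.card_Icc,
      Nat.sub_add_cancel hK, nsmul_eq_mul, mul_one] at h
    rw [Nat.cast_sub hK] at h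
    push_cast at h ⊢
    linear_combination h / 2
  | one => simp
  | more n ih₀ ih₁ =>
    have h := hζ.rootKernelSum_second_difference ((n + 1 : ℕ) : ℤ)
    simp only [zpow_natCast] at h
    rw [hζ.sum_Icc_pow_pow (by omega) (by omega)] at h
    have e₀ := ih₀ (by omega)
    have e₁ := ih₁ (by omega)
    rw [show ((n + 1 : ℕ) : ℤ) + 1 = ((n + 2 : ℕ) : ℤ) by push_cast; ring,
      show ((n + 1 : ℕ) : ℤ) - 1 = (n : ℤ) by push_cast; ring] at h
    push_cast at h e₀ e₁ ⊢
    linear_combination 2 * e₁ - e₀ - h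

end PrimitiveRootSums

lemma Complex.four_mul_sin_sq_eq (x : ℝ) :
    ((4 * Real.sin x ^ 2 : ℝ) : ℂ) =
      (1 - Complex.exp (2 * x * Complex.I)) * (1 - (Complex.exp (2 * x * Complex.I))⁻¹) := by
  have h := mul_inv_cancel₀ (Complex.exp_ne_zero (2 * x * Complex.I))
  have hc : 2 * Complex.cos (2 * x) =
      Complex.exp (2 * x * Complex.I) + (Complex.exp (2 * x * Complex.I))⁻¹ := by
    rw [Complex.two_cos, ← Complex.exp_neg, neg_mul]
  push_cast
  rw [Complex.cos_two_mul] at hc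
  linear_combination 4 * Complex.sin_sq_add_cos_sq (x : ℂ) - hc - h

lemma sum_exp_sub_exp_div_sin_sq (K : ℕ) (n : ℤ) :
    ∑ j ∈ Icc 1 (K - 1),
        (Complex.exp (2 * π * Complex.I * j / K) -
          Complex.exp (2 * π * Complex.I * j * n / K)) /
          ((4 * Real.sin (π * j / K) ^ 2 : ℝ) : ℂ) =
      rootKernelSum (Complex.exp (2 * π * Complex.I / K)) K 1 -
        rootKernelSum (Complex.exp (2 * π * Complex.I / K)) K n := by
  rw [rootKernelSum, rootKernelSum, ← sum_sub_distrib]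
  refine sum_congr rfl fun j _ => ?_
  have hz : Complex.exp (2 * ((π * j / K : ℝ) : ℂ) * Complex.I) =
      Complex.exp (2 * π * Complex.I / K) ^ j := by
    rw [← Complex.exp_nat_mul]; push_cast; ring_nf
  have hj : Complex.exp (2 * π * Complex.I * j / K) = Complex.exp (2 * π * Complex.I / K) ^ j := by
    rw [← Complex.exp_nat_mul]; ring_nf
  have hn : Complex.exp (2 * π * Complex.I * j * n / K) =
      (Complex.exp (2 * π * Complex.I / K) ^ j) ^ n := by
    rw [← Complex.exp_nat_mul, ← Complex.exp_int_mul]; ring_nf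
  rw [Complex.four_mul_sin_sq_eq, hz, hj, hn, zpow_one, sub_div]

/-- the trigonometric identity
`∑_{j=1}^{K−1} (e^{2πij/K} − e^{±2πijm/K})/(4 sin²(πj/K)) = (m−1)(K−m−1)/2`. -/
theorem stmt_4 (K : ℕ) (hK : 2 ≤ K) (m : ℕ) (hm : m ≤ K - 1) :
    (∑ j ∈ Finset.Icc 1 (K - 1),
        (Complex.exp (2 * π * Complex.I * j / K) -
          Complex.exp (2 * π * Complex.I * j * m / K)) /
          ((4 * Real.sin (π * j / K) ^ 2 : ℝ) : ℂ) =
      ((((m : ℝ) - 1) * ((K : ℝ) - m - 1) / 2 : ℝ) : ℂ)) ∧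
    (∑ j ∈ Finset.Icc 1 (K - 1),
        (Complex.exp (2 * π * Complex.I * j / K) -
          Complex.exp (-(2 * π * Complex.I * j * m) / K)) /
          ((4 * Real.sin (π * j / K) ^ 2 : ℝ) : ℂ) =
      ((((m : ℝ) - 1) * ((K : ℝ) - m - 1) / 2 : ℝ) : ℂ)) := by
  have hζ := Complex.isPrimitiveRoot_exp K (by omega)
  have hS := hζ.rootKernelSum_one_sub (by omega) (show m ≤ K by omega)
  constructor
  · have h := sum_exp_sub_exp_div_sin_sq K m
    rw [hS] at h
    push_cast at h ⊢
    exact h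
  · have h := sum_exp_sub_exp_div_sin_sq K (-m)
    rw [hζ.rootKernelSum_neg, hS] at h
    push_cast at h ⊢
    simpa only [mul_neg] using h
end

section
/- Let δ_+, δ_−, σ be real numbers with δ_+ > 0 and δ_− > 0, and consider the complex 2×2 matrix A = [[i·δ_+, i·σ], [−i·σ, −i·δ_−]]. Its eigenvalues are the two roots of λ² − i(δ_+ − δ_−)λ + (δ_+·δ_− − σ²) = 0. If |σ| ≤ (δ_+ + δ_−)/2, then both eigenvalues of A are purely imaginary (have zero real part). If |σ| > (δ_+ + δ_−)/2, then A has one eigenvalue with strictly positive real part and one eigenvalue with strictly negative real part. -/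
open Complex Matrix

/-- The eigenvalues of a `2 × 2` matrix are the roots of `X² - tr(A) X + det(A)`. -/
theorem hasEigenvalue_toLin'_fin_two_iff {K : Type*} [Field K] (A : Matrix (Fin 2) (Fin 2) K)
    (μ : K) : Module.End.HasEigenvalue (Matrix.toLin' A) μ ↔
      μ ^ 2 - A.trace * μ + A.det = 0 := by
  rw [Module.End.hasEigenvalue_iff_isRoot_charpoly, Matrix.charpoly_toLin',
    Matrix.charpoly_fin_two]
  simp [Polynomial.IsRoot.def]

/-- for the matrix `A = [[iδ₊, iσ], [−iσ, −iδ₋]]` with `δ₊, δ₋ > 0`,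
the eigenvalues are the roots of `λ² − i(δ₊−δ₋)λ + (δ₊δ₋ − σ²) = 0`; they are purely
imaginary when `|σ| ≤ (δ₊+δ₋)/2`, and otherwise one has strictly positive and one
strictly negative real part. -/
theorem stmt_5 (δp δm σ : ℝ) (hp : 0 < δp) (hm : 0 < δm)
    (A : Matrix (Fin 2) (Fin 2) ℂ)
    (hA : A = !![Complex.I * δp, Complex.I * σ; -Complex.I * σ, -Complex.I * δm]) :
    (∀ lam : ℂ, Module.End.HasEigenvalue (Matrix.toLin' A) lam ↔
      lam ^ 2 - Complex.I * ((δp : ℂ) - δm) * lam + ((δp : ℂ) * δm - (σ : ℂ) ^ 2) = 0) ∧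
    (|σ| ≤ (δp + δm) / 2 →
      ∀ lam : ℂ, Module.End.HasEigenvalue (Matrix.toLin' A) lam → lam.re = 0) ∧
    ((δp + δm) / 2 < |σ| →
      ∃ lam₁ lam₂ : ℂ, Module.End.HasEigenvalue (Matrix.toLin' A) lam₁ ∧
        Module.End.HasEigenvalue (Matrix.toLin' A) lam₂ ∧
        0 < lam₁.re ∧ lam₂.re < 0) := by
  have hchar (lam : ℂ) : Module.End.HasEigenvalue (Matrix.toLin' A) lam ↔
      lam ^ 2 - Complex.I * ((δp : ℂ) - δm) * lam + ((δp : ℂ) * δm - (σ : ℂ) ^ 2) = 0 := by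
    have htr : A.trace = Complex.I * ((δp : ℂ) - δm) := by
      rw [hA, Matrix.trace_fin_two_of]
      ring
    have hdet : A.det = (δp : ℂ) * δm - (σ : ℂ) ^ 2 := by
      rw [hA, Matrix.det_fin_two_of]
      linear_combination ((σ : ℂ) ^ 2 - δp * δm) * Complex.I_sq
    rw [hasEigenvalue_toLin'_fin_two_iff, htr, hdet]
  refine ⟨hchar, fun h lam hlam ↦ ?_, fun h ↦ ?_⟩
  · have heq := (hchar lam).1 hlam
    have hre := congrArg Complex.re heq
    have him := congrArg Complex.im heq
    simp [pow_two] at hre him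
    by_contra hx
    have hy : lam.im = (δp - δm) / 2 := by
      apply mul_left_cancel₀ hx
      linarith
    have hσ : σ ^ 2 ≤ ((δp + δm) / 2) ^ 2 := sq_le_sq' (abs_le.1 h).1 (abs_le.1 h).2
    rw [hy] at hre
    nlinarith [sq_pos_of_ne_zero hx]
  · have hσ : ((δp + δm) / 2) ^ 2 < σ ^ 2 := by
      rw [← sq_abs σ]
      gcongr
    set r := √(σ ^ 2 - ((δp + δm) / 2) ^ 2)
    have hr : 0 < r := Real.sqrt_pos.2 (sub_pos.2 hσ)
    have hr2 : (r : ℂ) ^ 2 = (σ : ℂ) ^ 2 - (((δp : ℂ) + δm) / 2) ^ 2 := by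
      exact_mod_cast Real.sq_sqrt (sub_pos.2 hσ).le
    refine ⟨⟨r, (δp - δm) / 2⟩, ⟨-r, (δp - δm) / 2⟩, (hchar _).2 ?_, (hchar _).2 ?_, hr,
      neg_lt_zero.2 hr⟩ <;>
    · rw [Complex.mk_eq_add_mul_I]
      push_cast
      linear_combination hr2 - (((δp : ℂ) - δm) / 2) ^ 2 * Complex.I_sq
end

section
/- For every integer K ≥ 2, the following are equivalent: (i) for every integer m with 1 ≤ m ≤ K−1, one has K·(m−2) − m² + 2 ≤ 0 (equivalently, (m−1)(K−m−1) ≤ K−1); (ii) K ≤ 7. In particular, for K ≥ 8 there exists m ∈ {1, …, K−1} (e.g. m = 4) with K·(m−2) − m² + 2 > 0. -/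
/-- for `K ≥ 2`, the quantity `K(m−2) − m² + 2` is `≤ 0` for all
`m ∈ {1,…,K−1}` (equivalently `(m−1)(K−m−1) ≤ K−1`) if and only if `K ≤ 7`;
for `K ≥ 8` the mode `m = 4` gives a positive value. -/
theorem stmt_8 (K : ℕ) (hK : 2 ≤ K) :
    (∀ m : ℕ, 1 ≤ m → m ≤ K - 1 →
      (((K : ℤ) * ((m : ℤ) - 2) - (m : ℤ) ^ 2 + 2 ≤ 0) ↔
        ((m : ℤ) - 1) * ((K : ℤ) - (m : ℤ) - 1) ≤ (K : ℤ) - 1)) ∧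
    ((∀ m : ℕ, 1 ≤ m → m ≤ K - 1 →
        (K : ℤ) * ((m : ℤ) - 2) - (m : ℤ) ^ 2 + 2 ≤ 0) ↔ K ≤ 7) ∧
    (8 ≤ K → 1 ≤ 4 ∧ 4 ≤ K - 1 ∧
      0 < (K : ℤ) * ((4 : ℤ) - 2) - (4 : ℤ) ^ 2 + 2) := by
  refine ⟨fun m _ _ => ?_, ⟨fun h => ?_, fun hK7 m hm hmK => ?_⟩, fun h8 => ?_⟩
  · constructor <;> intro h <;> linarith
  · by_contra! h7
    have h4 := h 4 (by norm_num) (by omega)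
    push_cast at h4
    omega
  · have hm6 : m ≤ 6 := by omega
    interval_cases m <;> norm_num <;> omega
  · refine ⟨by norm_num, by omega, ?_⟩
    omega
end

section
/- Let K ≥ 8 be an integer. Then the maximum of the quantity (K·(m−2) − m² + 2) / ((m/K + M)²), taken over all integers m with 1 ≤ m ≤ K−1 and all integers M (note m/K + M ≠ 0 for such m), equals K²·(K−7)/8, and it is attained at (m, M) = (4, 0). -/
theorem eight_mul_numerator_le {K m : ℤ} (hK : 8 ≤ K) (hm : 1 ≤ m) :
    8 * (K * (m - 2) - m ^ 2 + 2) ≤ (K - 7) * m ^ 2 := by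
  have key : 0 ≤ (m - 4) * (K * (m - 4) + m + 4) := by
    rcases le_or_gt 4 m with h | h
    · have : 0 ≤ K * (m - 4) := mul_nonneg (by lia) (by lia)
      exact mul_nonneg (by lia) (by lia)
    · interval_cases m <;> lia
  linarith [key]

theorem eight_mul_numerator_le_shift {K m : ℤ} (hK : 8 ≤ K) (hm : 1 ≤ m) (hmK : m ≤ K - 1)
    (M : ℤ) : 8 * (K * (m - 2) - m ^ 2 + 2) ≤ (K - 7) * (m + M * K) ^ 2 := by
  rcases le_or_gt 0 M with hM | hM
  · have h : 0 ≤ M * K := mul_nonneg hM (by lia)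
    calc 8 * (K * (m - 2) - m ^ 2 + 2) ≤ (K - 7) * m ^ 2 := eight_mul_numerator_le hK hm
      _ ≤ (K - 7) * (m + M * K) ^ 2 :=
        mul_le_mul_of_nonneg_left (pow_le_pow_left₀ (by lia) (by lia) 2) (by lia)
  · have h : 0 ≤ (-M - 1) * K := mul_nonneg (by lia) (by lia)
    calc 8 * (K * (m - 2) - m ^ 2 + 2)
        = 8 * (K * ((K - m) - 2) - (K - m) ^ 2 + 2) := by ring
      _ ≤ (K - 7) * (K - m) ^ 2 := eight_mul_numerator_le hK (by lia)
      _ ≤ (K - 7) * (-(m + M * K)) ^ 2 :=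
        mul_le_mul_of_nonneg_left (pow_le_pow_left₀ (by lia) (by linarith) 2) (by lia)
      _ = (K - 7) * (m + M * K) ^ 2 := by ring

theorem add_mul_ne_zero_of_pos_of_lt {K m : ℤ} (hm : 0 < m) (hmK : m < K) (M : ℤ) :
    m + M * K ≠ 0 := by
  intro h
  have hdvd : K ∣ m := ⟨-M, by linarith⟩
  exact absurd (Int.le_of_dvd hm hdvd) (not_le.mpr hmK)


/-- for `K ≥ 8`, the maximum of `(K(m−2) − m² + 2)/((m/K + M)²)` over
integers `1 ≤ m ≤ K−1` and `M ∈ ℤ` equals `K²(K−7)/8`, attained at `(m, M) = (4, 0)`. -/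
theorem stmt_9 (K : ℕ) (hK : 8 ≤ K) :
    (∀ m : ℕ, 1 ≤ m → m ≤ K - 1 → ∀ M : ℤ,
      ((K : ℝ) * ((m : ℝ) - 2) - (m : ℝ) ^ 2 + 2) / (((m : ℝ) / K + M) ^ 2) ≤
        (K : ℝ) ^ 2 * ((K : ℝ) - 7) / 8) ∧
    ((K : ℝ) * ((4 : ℝ) - 2) - (4 : ℝ) ^ 2 + 2) / (((4 : ℝ) / K + (0 : ℤ)) ^ 2) =
      (K : ℝ) ^ 2 * ((K : ℝ) - 7) / 8 := by
  have hK0 : (0 : ℝ) < K := by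
    exact_mod_cast (by lia : 0 < K)
  refine ⟨fun m hm hmK M => ?_, ?_⟩
  · have hn : (m : ℝ) + M * K ≠ 0 := by
      exact_mod_cast add_mul_ne_zero_of_pos_of_lt (K := K) (m := m) (by lia) (by lia) M
    have hle : 8 * ((K : ℝ) * (m - 2) - (m : ℝ) ^ 2 + 2) ≤ (K - 7) * (m + M * K) ^ 2 := by
      exact_mod_cast
        eight_mul_numerator_le_shift (K := K) (m := m) (by lia) (by lia) (by lia) M
    have hdenom : (m : ℝ) / K + M = (m + M * K) / K := by
      field_simp
    rw [hdenom, div_pow, div_div_eq_mul_div, div_le_div_iff₀ (by positivity) (by norm_num)]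
    linarith [mul_le_mul_of_nonneg_left hle (sq_nonneg (K : ℝ))]
  · push_cast
    field_simp
    ring
end

section
/- Let K ≥ 8 and q be integers with gcd(q, K) > 1. Then there exist an integer m with 1 ≤ m ≤ K−1 and an integer M such that m·q + M·K = 0 (i.e. m·q/K + M = 0) and K·(m−2) − m² + 2 > 0. Consequently the dynamical stability threshold s_{min,d} = max_{m,M} (K(m−2) − m² + 2)/((mq/K + M)²) is +∞, i.e. the (K,q) filament ring is dynamically unstable for every value of the dimensionless parameter s. -/
/-- If `q` and `K ≥ 8` share a factor `g > 1`, the multiple `⌊g / 2⌋ * (K / g)` of `K / g` is an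
azimuthal mode at which the longitudinal term can be cancelled while the destabilizing term is
positive. -/
theorem exists_resonant_mode (K : ℕ) (hK : 8 ≤ K) (q : ℤ) (hgcd : 1 < Int.gcd q (K : ℤ)) :
    ∃ m : ℕ, 1 ≤ m ∧ m ≤ K - 1 ∧ ∃ M : ℤ,
      (m : ℤ) * q + M * (K : ℤ) = 0 ∧
      0 < (K : ℤ) * ((m : ℤ) - 2) - (m : ℤ) ^ 2 + 2 := by
  obtain ⟨r, hr⟩ := Int.gcd_dvd_left q (K : ℤ)
  obtain ⟨k, hk⟩ : Int.gcd q (K : ℤ) ∣ K := Int.natCast_dvd_natCast.mp (Int.gcd_dvd_right q (K : ℤ))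
  generalize Int.gcd q (K : ℤ) = g at hgcd hr hk
  have hj : 1 ≤ g / 2 := by omega
  have hg : g = 2 * (g / 2) + g % 2 := by omega
  have hkpos : 1 ≤ k := by
    rcases Nat.eq_zero_or_pos k with rfl | h
    · omega
    · exact h
  have hkm : k ≤ g / 2 * k := Nat.le_mul_of_pos_left k hj
  have hKm : K = 2 * (g / 2 * k) + g % 2 * k := by
    conv_lhs => rw [hk, hg]
    ring
  refine ⟨g / 2 * k, by omega, ?_, -((g / 2 : ℕ) : ℤ) * r, ?_, ?_⟩
  · have : 0 ≤ g % 2 * k := Nat.zero_le _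
    omega
  · rw [hr, hk]
    push_cast
    ring
  · generalize g / 2 * k = m at hkm hKm
    rcases Nat.mod_two_eq_zero_or_one g with h | h <;> rw [h] at hKm
    · have hm : (4 : ℤ) ≤ m := by omega
      have hK' : (K : ℤ) = 2 * m := by omega
      rw [hK']
      nlinarith
    · have hK' : (K : ℤ) = 2 * m + k := by omega
      have hm : m = 3 ∨ 4 ≤ m := by omega
      rw [hK']
      rcases hm with rfl | hm
      · have : (2 : ℤ) ≤ k := by omega
        push_cast
        linarith
      · have hm' : (4 : ℤ) ≤ m := by omega
        have hk' : (1 : ℤ) ≤ k := by omega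
        nlinarith

/-- for `K ≥ 8` and `gcd(q, K) > 1`, there is an azimuthal mode
`m ∈ {1,…,K−1}` and a longitudinal mode `M ∈ ℤ` with `mq + MK = 0` and
`K(m−2) − m² + 2 > 0`; consequently for every value of the dimensionless parameter `s`
there is an unstable mode, i.e. the `(K,q)` ring is dynamically unstable for all `s`. -/
theorem stmt_10 (K : ℕ) (hK : 8 ≤ K) (q : ℤ) (hgcd : 1 < Int.gcd q (K : ℤ)) :
    (∃ m : ℕ, 1 ≤ m ∧ m ≤ K - 1 ∧ ∃ M : ℤ,
      (m : ℤ) * q + M * (K : ℤ) = 0 ∧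
      0 < (K : ℤ) * ((m : ℤ) - 2) - (m : ℤ) ^ 2 + 2) ∧
    (∀ s : ℝ, ∃ m : ℕ, 1 ≤ m ∧ m ≤ K - 1 ∧ ∃ M : ℤ,
      s * (((m : ℝ) * (q : ℝ) / (K : ℝ) + (M : ℝ)) ^ 2) <
        (K : ℝ) * ((m : ℝ) - 2) - (m : ℝ) ^ 2 + 2) := by
  have hres := exists_resonant_mode K hK q hgcd
  refine ⟨hres, fun s => ?_⟩
  obtain ⟨m, hm₁, hm₂, M, hM, hpos⟩ := hres
  refine ⟨m, hm₁, hm₂, M, ?_⟩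
  have hK₀ : (K : ℝ) ≠ 0 := Nat.cast_ne_zero.mpr (by omega)
  have hzero : (m : ℝ) * q / K + M = 0 := by
    rw [div_add' _ _ _ hK₀, div_eq_zero_iff]
    exact Or.inl (by exact_mod_cast hM)
  rw [hzero, zero_pow two_ne_zero, mul_zero]
  exact_mod_cast hpos
end

section
/- Let K ≥ 2 and q ≥ 1 be integers and s a real number, and define μ(s; m, M) = [1 + (s/(K−1))·(mq/K + M)·((m+2)q/K + M)]·[1 + (s/(K−1))·(mq/K + M)·((m−2)q/K + M)] − (m−1)²·(1 − m/(K−1))². Then μ(s; 0, 1) = s·[(K² − 4q²)·s + 2(K−1)·K²] / ((K−1)²·K²). Consequently: if 2q < K then μ(s; 0, 1) > 0 for all s > 0; if 2q > K then, for s > 0, μ(s; 0, 1) < 0 if and only if s > 2(K−1)·K²/(4q² − K²). -/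
/-- The energetic stability quantity `μ(s; m, M)` for a `(K,q)` filament ring. -/
noncomputable def ringMu (K q : ℕ) (s m M : ℝ) : ℝ :=
  (1 + s / ((K : ℝ) - 1) * (m * q / K + M) * ((m + 2) * q / K + M)) *
    (1 + s / ((K : ℝ) - 1) * (m * q / K + M) * ((m - 2) * q / K + M)) -
  (m - 1) ^ 2 * (1 - m / ((K : ℝ) - 1)) ^ 2

/-- Closed form of `μ(s; 0, 1)`. -/
theorem ringMu_zero_one {K : ℕ} (hK : 2 ≤ K) (q : ℕ) (s : ℝ) :
    ringMu K q s 0 1 =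
      s * (((K : ℝ) ^ 2 - 4 * (q : ℝ) ^ 2) * s + 2 * ((K : ℝ) - 1) * (K : ℝ) ^ 2) /
        (((K : ℝ) - 1) ^ 2 * (K : ℝ) ^ 2) := by
  have hK' : (2 : ℝ) ≤ K := by exact_mod_cast hK
  have h0 : (K : ℝ) ≠ 0 := by linarith
  have h1 : (K : ℝ) - 1 ≠ 0 := by linarith
  unfold ringMu
  field_simp
  ring

/-- `μ(s; 0, 1) = s((K² − 4q²)s + 2(K−1)K²)/((K−1)²K²)`; for `2q < K`
this mode is stable for all `s > 0`, while for `2q > K` it is unstable precisely when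
`s > 2(K−1)K²/(4q² − K²)`. -/
theorem stmt_13 (K q : ℕ) (hK : 2 ≤ K) (hq : 1 ≤ q) :
    (∀ s : ℝ, ringMu K q s 0 1 =
      s * (((K : ℝ) ^ 2 - 4 * (q : ℝ) ^ 2) * s + 2 * ((K : ℝ) - 1) * (K : ℝ) ^ 2) /
        (((K : ℝ) - 1) ^ 2 * (K : ℝ) ^ 2)) ∧
    (2 * q < K → ∀ s : ℝ, 0 < s → 0 < ringMu K q s 0 1) ∧
    (K < 2 * q → ∀ s : ℝ, 0 < s →
      (ringMu K q s 0 1 < 0 ↔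
        2 * ((K : ℝ) - 1) * (K : ℝ) ^ 2 / (4 * (q : ℝ) ^ 2 - (K : ℝ) ^ 2) < s)) := by
  have hK' : (2 : ℝ) ≤ K := by exact_mod_cast hK
  have h0 : (0 : ℝ) < K := by linarith
  have h1 : (0 : ℝ) < K - 1 := by linarith
  have hden : (0 : ℝ) < ((K : ℝ) - 1) ^ 2 * (K : ℝ) ^ 2 := by positivity
  refine ⟨ringMu_zero_one hK q, fun h s hs => ?_, fun h s hs => ?_⟩
  · have h' : 2 * (q : ℝ) < K := by exact_mod_cast h
    have hsq : (0 : ℝ) < (K : ℝ) ^ 2 - 4 * (q : ℝ) ^ 2 := by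
      nlinarith [(q.cast_nonneg : (0 : ℝ) ≤ q)]
    rw [ringMu_zero_one hK]
    positivity
  · have h' : (K : ℝ) < 2 * q := by exact_mod_cast h
    have hsq : (0 : ℝ) < 4 * (q : ℝ) ^ 2 - (K : ℝ) ^ 2 := by nlinarith
    rw [ringMu_zero_one hK, div_lt_iff₀ hden, zero_mul, mul_neg_iff,
      div_lt_iff₀ hsq]
    simp only [hs, hs.not_gt, true_and, false_and, or_false]
    constructor <;> intro <;> linarith
end

section
/- Let K ≥ 2, let η_1, …, η_K ∈ ℂ be pairwise distinct, and let Γ > 0 satisfy the relative-equilibrium equations Γ·η_k = ∑_{j≠k} (η_k − η_j)/|η_k − η_j|² for all k. Define the ℂ-linear operators L and L̄ on ℂ^K by (Lφ)_k = −∑_{j≠k} (φ_k − φ_j)/(conj(η_k) − conj(η_j))² and (L̄φ)_k = −∑_{j≠k} (φ_k − φ_j)/(η_k − η_j)². Then L applied to the vector η̄ = (conj(η_1), …, conj(η_K)) satisfies L(η̄) = −Γ·η, and L̄(L(η̄)) = Γ²·η̄. In particular, Γ² is an eigenvalue of the operator L̄L with eigenvector η̄. -/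
open Finset Complex

/-- The linearization operator `L` of the point-vortex system about `η`. -/
noncomputable def Lop {K : ℕ} (η : Fin K → ℂ) (φ : Fin K → ℂ) : Fin K → ℂ :=
  fun k => -∑ j ∈ Finset.univ.erase k,
    (φ k - φ j) / ((starRingEnd ℂ) (η k) - (starRingEnd ℂ) (η j)) ^ 2

/-- The conjugate linearization operator `L̄`. -/
noncomputable def Lbar {K : ℕ} (η : Fin K → ℂ) (φ : Fin K → ℂ) : Fin K → ℂ :=
  fun k => -∑ j ∈ Finset.univ.erase k, (φ k - φ j) / (η k - η j) ^ 2

/-- Also valid at `a = 0`, where both sides vanish. -/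
lemma div_norm_sq_eq_inv_conj (a : ℂ) :
    a / ((‖a‖ : ℂ) ^ 2) = ((starRingEnd ℂ) a)⁻¹ := by
  rw [← Complex.mul_conj', div_mul_eq_div_div]
  rcases eq_or_ne a 0 with rfl | ha
  · simp
  · rw [div_self ha, one_div]

lemma div_sq_self_eq_inv (a : ℂ) : a / a ^ 2 = a⁻¹ := by
  rcases eq_or_ne a 0 with rfl | ha
  · simp
  · field_simp

/-- at a relative equilibrium with rate `Γ > 0`, `L(η̄) = −Γ·η` and
`L̄(L(η̄)) = Γ²·η̄`; in particular `Γ²` is an eigenvalue of `L̄L` with eigenvector `η̄`. -/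
theorem stmt_14 (K : ℕ) (hK : 2 ≤ K) (η : Fin K → ℂ)
    (hdist : ∀ j k : Fin K, j ≠ k → η j ≠ η k) (Γ : ℝ) (hΓ : 0 < Γ)
    (heq : ∀ k : Fin K,
      (Γ : ℂ) * η k =
        ∑ j ∈ Finset.univ.erase k, (η k - η j) / ((‖η k - η j‖ : ℂ) ^ 2)) :
    (Lop η (fun k => (starRingEnd ℂ) (η k)) = fun k => -(Γ : ℂ) * η k) ∧
    (Lbar η (Lop η (fun k => (starRingEnd ℂ) (η k))) =
      fun k => (Γ : ℂ) ^ 2 * (starRingEnd ℂ) (η k)) ∧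
    (fun k : Fin K => (starRingEnd ℂ) (η k)) ≠ 0 := by
  have equil (k : Fin K) : (Γ : ℂ) * η k =
      ∑ j ∈ Finset.univ.erase k, ((starRingEnd ℂ) (η k) - (starRingEnd ℂ) (η j))⁻¹ := by
    simpa only [div_norm_sq_eq_inv_conj, map_sub] using heq k
  have equil_conj (k : Fin K) : (Γ : ℂ) * (starRingEnd ℂ) (η k) =
      ∑ j ∈ Finset.univ.erase k, (η k - η j)⁻¹ := by
    simpa only [map_mul, map_sum, map_inv₀, map_sub, Complex.conj_conj, Complex.conj_ofReal]
      using congrArg (starRingEnd ℂ) (equil k)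
  have hL : Lop η (fun k => (starRingEnd ℂ) (η k)) = fun k => -(Γ : ℂ) * η k := by
    funext k
    simp only [Lop, div_sq_self_eq_inv, ← equil k, neg_mul]
  refine ⟨hL, ?_, fun h => ?_⟩
  · funext k
    have hterm (j : Fin K) : (-(Γ : ℂ) * η k - -(Γ : ℂ) * η j) / (η k - η j) ^ 2 =
        -(Γ : ℂ) * (η k - η j)⁻¹ := by
      rw [← mul_sub, mul_div_assoc, div_sq_self_eq_inv]
    simp only [hL, Lbar, hterm]
    rw [← Finset.mul_sum, ← equil_conj k]
    ring
  · have hzero (k : Fin K) : η k = 0 := by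
      simpa using congrFun h k
    exact hdist ⟨0, by omega⟩ ⟨1, by omega⟩ (by simp) (by rw [hzero, hzero])
end

section
/- Let K ≥ 2, let η_1, …, η_K ∈ ℂ be pairwise distinct, and let Γ > 0 satisfy Γ·η_k = ∑_{j≠k} (η_k − η_j)/|η_k − η_j|² for all k. Define the operators L and L̄ on ℂ^K by (Lφ)_k = −∑_{j≠k} (φ_k − φ_j)/(conj(η_k) − conj(η_j))² and (L̄φ)_k = −∑_{j≠k} (φ_k − φ_j)/(η_k − η_j)². Assume the equilibrium is stable in the sense that every real number κ for which there exists a nonzero φ ∈ ℂ^K with (κ + Γ)·φ_k = (L(conj(φ)))_k for all k satisfies κ ≤ 0. Then every eigenvalue μ of the ℂ-linear operator L̄∘L is real and satisfies 0 ≤ μ ≤ Γ². -/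
open Finset Complex

lemma Lbar_apply {K : ℕ} (η φ : Fin K → ℂ) (k : Fin K) :
    Lbar η φ k = -∑ j, (φ k - φ j) / (η k - η j) ^ 2 := by
  rw [Lbar, ← Finset.add_sum_erase _ _ (Finset.mem_univ k)]
  simp

/-- `L̄` is a complex symmetric operator. -/
lemma sum_mul_Lbar {K : ℕ} (η f g : Fin K → ℂ) :
    ∑ k, f k * Lbar η g k = ∑ k, Lbar η f k * g k := by
  rw [← sub_eq_zero, ← Finset.sum_sub_distrib]
  have h : ∀ k, f k * Lbar η g k - Lbar η f k * g k =
      ∑ j, f k * g j / (η k - η j) ^ 2 - ∑ j, f j * g k / (η j - η k) ^ 2 := by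
    intro k
    rw [Lbar_apply, Lbar_apply, mul_neg, neg_mul, Finset.mul_sum, Finset.sum_mul,
      neg_sub_neg, ← Finset.sum_sub_distrib, ← Finset.sum_sub_distrib]
    refine Finset.sum_congr rfl fun j _ => ?_
    rw [show (η j - η k) ^ 2 = (η k - η j) ^ 2 by ring]
    ring
  simp_rw [h]
  rw [Finset.sum_sub_distrib, sub_eq_zero]
  exact Finset.sum_comm

lemma conj_Lop {K : ℕ} (η φ : Fin K → ℂ) (k : Fin K) :
    (starRingEnd ℂ) (Lop η φ k) = Lbar η (fun j => (starRingEnd ℂ) (φ j)) k := by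
  simp [Lop, Lbar]

lemma conj_Lbar {K : ℕ} (η φ : Fin K → ℂ) (k : Fin K) :
    (starRingEnd ℂ) (Lbar η φ k) = Lop η (fun j => (starRingEnd ℂ) (φ j)) k := by
  simp [Lop, Lbar]

lemma Lop_add_mul {K : ℕ} (η φ ψ : Fin K → ℂ) (c : ℂ) (k : Fin K) :
    Lop η (fun j => φ j + c * ψ j) k = Lop η φ k + c * Lop η ψ k := by
  simp only [Lop]
  rw [mul_neg, ← neg_add, Finset.mul_sum, ← Finset.sum_add_distrib]
  congr 1
  refine Finset.sum_congr rfl fun j _ => ?_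
  ring

lemma Lop_mul {K : ℕ} (η ψ : Fin K → ℂ) (c : ℂ) (k : Fin K) :
    Lop η (fun j => c * ψ j) k = c * Lop η ψ k := by
  simp only [Lop]
  rw [mul_neg, Finset.mul_sum]
  congr 1
  refine Finset.sum_congr rfl fun j _ => ?_
  ring

/-- Eigenvalues of `L̄ ∘ L` are real and nonnegative, since `L̄` is the adjoint of `L`. -/
lemma eigenvalue_Lbar_Lop_nonneg {K : ℕ} {η φ : Fin K → ℂ} {μ : ℂ} (hφ : φ ≠ 0)
    (h : Lbar η (Lop η φ) = fun k => μ * φ k) : μ.im = 0 ∧ 0 ≤ μ.re := by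
  have key : μ * ((∑ k, normSq (φ k) : ℝ) : ℂ) = ((∑ k, normSq (Lop η φ k) : ℝ) : ℂ) := by
    have hsym := sum_mul_Lbar η (fun j => (starRingEnd ℂ) (φ j)) (Lop η φ)
    simp_rw [h, ← conj_Lop, ← normSq_eq_conj_mul_self] at hsym
    push_cast
    rw [← hsym, Finset.mul_sum]
    refine Finset.sum_congr rfl fun k _ => ?_
    rw [normSq_eq_conj_mul_self]
    ring
  have hpos : 0 < ∑ k, normSq (φ k) := by
    obtain ⟨k, hk⟩ := Function.ne_iff.mp hφ
    exact Finset.sum_pos' (fun _ _ => normSq_nonneg _) ⟨k, Finset.mem_univ k, normSq_pos.mpr hk⟩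
  have hnn : 0 ≤ ∑ k, normSq (Lop η φ k) := Finset.sum_nonneg fun _ _ => normSq_nonneg _
  have hre := congrArg Complex.re key
  have him := congrArg Complex.im key
  rw [re_mul_ofReal, ofReal_re] at hre
  rw [im_mul_ofReal, ofReal_im] at him
  refine ⟨(mul_eq_zero.mp him).resolve_right hpos.ne', ?_⟩
  exact nonneg_of_mul_nonneg_left (hre ▸ hnn) hpos

/-- An eigenvalue `s ^ 2` of `L̄ ∘ L` gives the coneigenvalue `s` of `L`. -/
lemma exists_coneigenvector {K : ℕ} {η φ : Fin K → ℂ} {s : ℝ} (hφ : φ ≠ 0)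
    (h : Lbar η (Lop η φ) = fun k => (s : ℂ) ^ 2 * φ k) :
    ∃ ψ : Fin K → ℂ, ψ ≠ 0 ∧
      ∀ k, (s : ℂ) * ψ k = Lop η (fun j => (starRingEnd ℂ) (ψ j)) k := by
  by_cases hψ : (fun k => Lop η φ k + s * (starRingEnd ℂ) (φ k)) = 0
  · refine ⟨fun k => I * (starRingEnd ℂ) (φ k), ?_, fun k => ?_⟩
    · obtain ⟨k, hk⟩ := Function.ne_iff.mp hφ
      exact Function.ne_iff.mpr ⟨k, mul_ne_zero I_ne_zero ((map_ne_zero _).mpr hk)⟩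
    · have hk : Lop η φ k + s * (starRingEnd ℂ) (φ k) = 0 := congrFun hψ k
      simp only [map_mul, conj_I, conj_conj]
      rw [Lop_mul]
      linear_combination I * hk
  · refine ⟨_, hψ, fun k => ?_⟩
    simp only [map_add, map_mul, conj_conj, conj_ofReal]
    have hk := congrArg (starRingEnd ℂ) (congrFun h k)
    rw [conj_Lbar] at hk
    simp only [map_mul, map_pow, conj_ofReal] at hk
    rw [Lop_add_mul, hk]
    ring

/-- if the relative equilibrium is energetically stable (every real
growth rate `κ` of the linearization `(κ + Γ)φ = L(φ̄)` satisfies `κ ≤ 0`), then every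
eigenvalue `μ` of the operator `L̄∘L` is real and satisfies `0 ≤ μ ≤ Γ²`. -/
theorem stmt_15 (K : ℕ) (hK : 2 ≤ K) (η : Fin K → ℂ)
    (hdist : ∀ j k : Fin K, j ≠ k → η j ≠ η k) (Γ : ℝ) (hΓ : 0 < Γ)
    (heq : ∀ k : Fin K,
      (Γ : ℂ) * η k =
        ∑ j ∈ Finset.univ.erase k, (η k - η j) / ((‖η k - η j‖ : ℂ) ^ 2))
    (hstab : ∀ κ : ℝ,
      (∃ φ : Fin K → ℂ, φ ≠ 0 ∧
        ∀ k : Fin K, ((κ : ℂ) + Γ) * φ k = Lop η (fun j => (starRingEnd ℂ) (φ j)) k) →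
      κ ≤ 0) :
    ∀ μ : ℂ, (∃ φ : Fin K → ℂ, φ ≠ 0 ∧ Lbar η (Lop η φ) = fun k => μ * φ k) →
      μ.im = 0 ∧ 0 ≤ μ.re ∧ μ.re ≤ Γ ^ 2 := by
  rintro μ ⟨φ, hφ, h⟩
  obtain ⟨him, hre⟩ := eigenvalue_Lbar_Lop_nonneg hφ h
  refine ⟨him, hre, ?_⟩
  have hμ : μ = (√μ.re : ℂ) ^ 2 := by
    rw [← ofReal_pow, Real.sq_sqrt hre]
    exact Complex.ext rfl him
  rw [hμ] at h
  obtain ⟨ψ, hψ, hL⟩ := exists_coneigenvector hφ h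
  have hle := hstab (√μ.re - Γ) ⟨ψ, hψ, fun k => by
    rw [← hL k]
    push_cast
    ring⟩
  exact (Real.sqrt_le_left hΓ.le).mp (by linarith)
end

section
/- Let D > 0, P > 0 be real numbers, l an integer, ω = 2πl/P, and let Ω be real with Γ := D·ω² + Ω > 0. Then the following are equivalent: (i) for every nonzero integer M, setting α = 2πM/P, and for every μ with 0 ≤ μ ≤ Γ², every real root λ of λ² + 2λ·(D·α² + Γ) + D·α²·(D·α² − 4D·ω² + 2Γ) + Γ² − μ = 0 satisfies λ ≤ 0; (ii) Ω ≥ D·(2π/P)²·(l² − 1/2). -/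
open Real

/-- The real roots of a quadratic with negative vertex are all nonpositive iff its constant
term is nonnegative. -/
lemma forall_root_nonpos_iff {b c : ℝ} (hb : 0 < b) :
    (∀ x : ℝ, x ^ 2 + 2 * x * b + c = 0 → x ≤ 0) ↔ 0 ≤ c := by
  constructor
  · intro h
    by_contra! hc
    have hroot := h (-b + √(b ^ 2 - c)) (by
      linear_combination Real.sq_sqrt (show 0 ≤ b ^ 2 - c by nlinarith [sq_nonneg b]))
    have hlt : b < √(b ^ 2 - c) := Real.lt_sqrt_of_sq_lt (by linarith)
    linarith
  · intro hc x hx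
    by_contra! hpos
    nlinarith [mul_pos hpos hb, pow_pos hpos 2]

/-- energetic stability criterion for the helical filament lattice with
`l` twists: all real growth rates `λ` of every mode `M ≠ 0` and every `μ ∈ [0, Γ²]`
are `≤ 0` if and only if `Ω ≥ D(2π/P)²(l² − 1/2)`. -/
theorem stmt_16 (D P : ℝ) (hD : 0 < D) (hP : 0 < P) (l : ℤ)
    (ω : ℝ) (hω : ω = 2 * π * (l : ℝ) / P)
    (Ω : ℝ) (Γ : ℝ) (hΓdef : Γ = D * ω ^ 2 + Ω) (hΓ : 0 < Γ) :
    ((∀ M : ℤ, M ≠ 0 → ∀ μ : ℝ, 0 ≤ μ → μ ≤ Γ ^ 2 → ∀ lam : ℝ,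
        lam ^ 2 + 2 * lam * (D * (2 * π * (M : ℝ) / P) ^ 2 + Γ) +
          D * (2 * π * (M : ℝ) / P) ^ 2 *
            (D * (2 * π * (M : ℝ) / P) ^ 2 - 4 * D * ω ^ 2 + 2 * Γ) +
          Γ ^ 2 - μ = 0 →
        lam ≤ 0) ↔
      D * (2 * π / P) ^ 2 * ((l : ℝ) ^ 2 - 1 / 2) ≤ Ω) := by
  have hk : 0 < D * (2 * π / P) ^ 2 := by positivity
  set k := D * (2 * π / P) ^ 2 with hkdef
  have hmode : ∀ M : ℤ, D * (2 * π * (M : ℝ) / P) ^ 2 = k * (M : ℝ) ^ 2 := by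
    intro M
    rw [hkdef]
    ring
  have hDω : D * ω ^ 2 = k * (l : ℝ) ^ 2 := by rw [hω, hmode]
  simp only [hmode, add_sub_assoc, add_assoc (_ ^ 2 + _)]
  constructor
  · intro h
    have hone := (forall_root_nonpos_iff (by push_cast; linarith)).1
      (h 1 one_ne_zero (Γ ^ 2) (sq_nonneg Γ) le_rfl)
    push_cast at hone
    have hfac : 0 ≤ k * (k - 4 * D * ω ^ 2 + 2 * Γ) := by linear_combination hone
    have := nonneg_of_mul_nonneg_right hfac hk
    linarith
  · intro h M hM μ _ hμ
    have hM1 : (1 : ℝ) ≤ (M : ℝ) ^ 2 := by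
      exact_mod_cast (one_le_sq_iff_one_le_abs M).2 (Int.one_le_abs hM)
    have hkM : k ≤ k * (M : ℝ) ^ 2 := le_mul_of_one_le_right hk.le hM1
    refine (forall_root_nonpos_iff (by linarith)).2 ?_
    have hfac : 0 ≤ k * (M : ℝ) ^ 2 - 4 * D * ω ^ 2 + 2 * Γ := by linarith
    have hprod := mul_nonneg (hk.le.trans hkM) hfac
    linarith
end

section
/- Let D ≥ 0, Γ > 0, and let ω, α be real numbers. Then for every real μ with 0 ≤ μ ≤ Γ², every complex root λ of λ² + 4i·D·ω·α·λ + D·α²·(D·α² − 4D·ω² + 2Γ) + Γ² − μ = 0 is purely imaginary (has zero real part). Explicitly, the roots are λ = i·(−2Dωα ± √(D·α²·(D·α² + 2Γ) + Γ² − μ)), and the quantity under the square root is nonnegative. -/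
open Real Complex

/-- dynamical stability of the helical filament lattice: for
`μ ∈ [0, Γ²]`, every complex root of
`λ² + 4iDωαλ + Dα²(Dα² − 4Dω² + 2Γ) + Γ² − μ = 0` is purely imaginary; explicitly the
roots are `λ = i(−2Dωα ± √(Dα²(Dα² + 2Γ) + Γ² − μ))` with a nonnegative radicand. -/
theorem stmt_17 (D Γ ω α : ℝ) (hD : 0 ≤ D) (hΓ : 0 < Γ)
    (μ : ℝ) (hμ0 : 0 ≤ μ) (hμΓ : μ ≤ Γ ^ 2) :
    0 ≤ D * α ^ 2 * (D * α ^ 2 + 2 * Γ) + Γ ^ 2 - μ ∧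
    (∀ lam : ℂ,
      lam ^ 2 + 4 * Complex.I * (D : ℂ) * (ω : ℂ) * (α : ℂ) * lam +
          ((D * α ^ 2 * (D * α ^ 2 - 4 * D * ω ^ 2 + 2 * Γ) + Γ ^ 2 - μ : ℝ) : ℂ) = 0 ↔
        (lam = Complex.I * ((-(2 * D * ω * α) +
            Real.sqrt (D * α ^ 2 * (D * α ^ 2 + 2 * Γ) + Γ ^ 2 - μ) : ℝ) : ℂ) ∨
         lam = Complex.I * ((-(2 * D * ω * α) -
            Real.sqrt (D * α ^ 2 * (D * α ^ 2 + 2 * Γ) + Γ ^ 2 - μ) : ℝ) : ℂ))) ∧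
    (∀ lam : ℂ,
      lam ^ 2 + 4 * Complex.I * (D : ℂ) * (ω : ℂ) * (α : ℂ) * lam +
          ((D * α ^ 2 * (D * α ^ 2 - 4 * D * ω ^ 2 + 2 * Γ) + Γ ^ 2 - μ : ℝ) : ℂ) = 0 →
        lam.re = 0) := by
  have hR : 0 ≤ D * α ^ 2 * (D * α ^ 2 + 2 * Γ) + Γ ^ 2 - μ := by
    have h : 0 ≤ D * α ^ 2 * (D * α ^ 2 + 2 * Γ) := by positivity
    linarith
  have hs := Real.sq_sqrt hR
  set s := Real.sqrt (D * α ^ 2 * (D * α ^ 2 + 2 * Γ) + Γ ^ 2 - μ)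
  have hsC : (s : ℂ) ^ 2 = D * α ^ 2 * (D * α ^ 2 + 2 * Γ) + Γ ^ 2 - μ := by
    exact_mod_cast hs
  have key : ∀ lam : ℂ,
      lam ^ 2 + 4 * Complex.I * (D : ℂ) * (ω : ℂ) * (α : ℂ) * lam +
          ((D * α ^ 2 * (D * α ^ 2 - 4 * D * ω ^ 2 + 2 * Γ) + Γ ^ 2 - μ : ℝ) : ℂ) = 0 ↔
        (lam = Complex.I * ((-(2 * D * ω * α) + s : ℝ) : ℂ) ∨
         lam = Complex.I * ((-(2 * D * ω * α) - s : ℝ) : ℂ)) := by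
    intro lam
    rw [← sub_eq_zero (b := Complex.I * ((-(2 * D * ω * α) + s : ℝ) : ℂ)),
      ← sub_eq_zero (b := Complex.I * ((-(2 * D * ω * α) - s : ℝ) : ℂ)), ← mul_eq_zero]
    refine Eq.congr_left ?_
    push_cast
    linear_combination ((s : ℂ) ^ 2 - (2 * D * ω * α) ^ 2) * Complex.I_sq - hsC
  refine ⟨hR, key, fun lam h => ?_⟩
  rcases (key lam).1 h with rfl | rfl <;> rw [Complex.I_mul_re, Complex.ofReal_im, neg_zero]
end

section
/- Let K ≥ 8 be an integer and for real s define μ(s; 4, 0) = (1 + 24s/((K−1)K²))·(1 + 8s/((K−1)K²)) − 9·((K−5)/(K−1))². Then ((K−1)²·K⁴/192)·μ(s; 4, 0) = s² + (K²(K−1)/6)·s − K⁴(K−4)(K−7)/24. Moreover the quadratic s² + (K²(K−1)/6)·s − K⁴(K−4)(K−7)/24 has exactly one positive root s₀, and for s ≥ 0 one has μ(s; 4, 0) ≥ 0 if and only if s ≥ s₀. -/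
/-- A monic real quadratic with negative constant coefficient has a positive root, and factors
accordingly. -/
theorem exists_pos_root_factorization (b : ℝ) {c : ℝ} (hc : 0 < c) :
    ∃ r : ℝ, 0 < r ∧ ∀ s : ℝ, s ^ 2 + b * s - c = (s - r) * (s + (r + b)) := by
  have hsq : √(b ^ 2 + 4 * c) ^ 2 = b ^ 2 + 4 * c := Real.sq_sqrt (by positivity)
  have hlt : b < √(b ^ 2 + 4 * c) := Real.lt_sqrt_of_sq_lt (by linarith)
  exact ⟨(√(b ^ 2 + 4 * c) - b) / 2, by linarith, fun s => by linear_combination hsq / 4⟩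

/-- for `K ≥ 8`, writing
`μ(s; 4, 0) = (1 + 24s/((K−1)K²))(1 + 8s/((K−1)K²)) − 9((K−5)/(K−1))²`, one has
`((K−1)²K⁴/192)·μ(s;4,0) = s² + (K²(K−1)/6)s − K⁴(K−4)(K−7)/24`; the quadratic has
exactly one positive root `s₀`, and for `s ≥ 0` one has `μ(s;4,0) ≥ 0` iff `s ≥ s₀`. -/
theorem stmt_18 (K : ℕ) (hK : 8 ≤ K)
    (mu40 : ℝ → ℝ)
    (hmu : ∀ s : ℝ, mu40 s =
      (1 + 24 * s / (((K : ℝ) - 1) * (K : ℝ) ^ 2)) *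
        (1 + 8 * s / (((K : ℝ) - 1) * (K : ℝ) ^ 2)) -
      9 * (((K : ℝ) - 5) / ((K : ℝ) - 1)) ^ 2) :
    (∀ s : ℝ, ((K : ℝ) - 1) ^ 2 * (K : ℝ) ^ 4 / 192 * mu40 s =
      s ^ 2 + (K : ℝ) ^ 2 * ((K : ℝ) - 1) / 6 * s -
        (K : ℝ) ^ 4 * ((K : ℝ) - 4) * ((K : ℝ) - 7) / 24) ∧
    (∃ s₀ : ℝ, 0 < s₀ ∧
      (s₀ ^ 2 + (K : ℝ) ^ 2 * ((K : ℝ) - 1) / 6 * s₀ -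
        (K : ℝ) ^ 4 * ((K : ℝ) - 4) * ((K : ℝ) - 7) / 24 = 0) ∧
      (∀ s' : ℝ, 0 < s' →
        s' ^ 2 + (K : ℝ) ^ 2 * ((K : ℝ) - 1) / 6 * s' -
          (K : ℝ) ^ 4 * ((K : ℝ) - 4) * ((K : ℝ) - 7) / 24 = 0 → s' = s₀) ∧
      (∀ s : ℝ, 0 ≤ s → (0 ≤ mu40 s ↔ s₀ ≤ s))) := by
  have hK' : (8 : ℝ) ≤ K := by exact_mod_cast hK
  have h0 : (0 : ℝ) < K := by linarith
  have h1 : (0 : ℝ) < (K : ℝ) - 1 := by linarith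
  have h4 : (0 : ℝ) < (K : ℝ) - 4 := by linarith
  have h7 : (0 : ℝ) < (K : ℝ) - 7 := by linarith
  have hquad : ∀ s : ℝ, ((K : ℝ) - 1) ^ 2 * (K : ℝ) ^ 4 / 192 * mu40 s =
      s ^ 2 + (K : ℝ) ^ 2 * ((K : ℝ) - 1) / 6 * s -
        (K : ℝ) ^ 4 * ((K : ℝ) - 4) * ((K : ℝ) - 7) / 24 := by
    intro s
    rw [hmu]
    field_simp
    ring
  have hb : 0 < (K : ℝ) ^ 2 * ((K : ℝ) - 1) / 6 := by positivity
  have hc : 0 < (K : ℝ) ^ 4 * ((K : ℝ) - 4) * ((K : ℝ) - 7) / 24 := by positivity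
  obtain ⟨r, hr, hfac⟩ := exists_pos_root_factorization _ hc
  refine ⟨hquad, r, hr, by rw [hfac, sub_self, zero_mul], fun s hs h => ?_, fun s hs => ?_⟩
  · rw [hfac] at h
    rcases mul_eq_zero.mp h with h | h <;> linarith
  · have hpos : 0 < ((K : ℝ) - 1) ^ 2 * (K : ℝ) ^ 4 / 192 := by positivity
    rw [← mul_nonneg_iff_of_pos_left hpos, hquad, hfac,
      mul_nonneg_iff_of_pos_right (by linarith), sub_nonneg]
end
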